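/- arXiv:1504.04879 — 2 statements merged into one kernel-verified Lean document; each statement's English description precedes it below -/
import Mathlib

section
/- In R = MvPolynomial (Fin 8) ℤ, the second elementary symmetric function of the multiset W((2,2,2,2,2), 8) of weights of semistandard Young tableaux of shape (2,2,2,2,2) with entries in {0,…,7} is congruent to 700·e₂ modulo the ideal generated by e₁; equivalently, c₂(γ₈^{(2,2,2,2,2)}) = 700·c₂(γ₈), the Table 1 entry for the weight 2α₅ of SL₈/μ₂. -/
open MvPolynomial

open scoped Classical in
/-- The multiset `W(lam, n)` of weights of semistandard Young tableaux of shape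
`lam` (a list of row lengths) with entries in `{0, …, n-1}`: a tableau assigns
to each cell `(i, j)` of the Young diagram of `lam` an entry in `Fin n`, weakly
increasing along rows and strictly increasing down columns; its weight is the
sum `∑_{(i,j) ∈ lam} X_{T(i,j)}`. -/
noncomputable def ssytWeights (lam : List ℕ) (n : ℕ) :
    Multiset (MvPolynomial (Fin n) ℤ) :=
  ((Finset.univ : Finset ((i : Fin lam.length) → Fin (lam.get i) → Fin n)).filter
      (fun T =>
        (∀ (i : Fin lam.length) (j j' : Fin (lam.get i)), (j : ℕ) ≤ (j' : ℕ) → T i j ≤ T i j') ∧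
        (∀ (i i' : Fin lam.length), (i : ℕ) < (i' : ℕ) →
          ∀ (j : Fin (lam.get i')) (hj : (j : ℕ) < lam.get i), T i ⟨j, hj⟩ < T i' j))).val.map
    (fun T => ∑ i, ∑ j, MvPolynomial.X (T i j))

theorem Multiset.two_mul_esymm_two {R : Type*} [CommRing R] (s : Multiset R) :
    2 * s.esymm 2 = s.sum ^ 2 - (s.map (· ^ 2)).sum := by
  induction s using Multiset.induction_on with
  | empty => simp [Multiset.esymm, Multiset.powersetCard_zero_right]
  | cons a s ih =>
    have h : (a ::ₘ s).esymm 2 = s.esymm 2 + a * s.sum := by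
      simp [Multiset.esymm, Multiset.powersetCard_cons, Multiset.powersetCard_one,
        Multiset.map_map]
      exact Multiset.sum_map_mul_left.trans (by simp)
    rw [h, mul_add, ih, Multiset.sum_cons, Multiset.map_cons, Multiset.sum_cons]
    ring

/-- The lists of length `k` with entries in `c` that are pairwise related by `r`. -/
def pairwiseLists {α : Type*} (r : α → α → Bool) : ℕ → List α → List (List α)
  | 0, _ => [[]]
  | k + 1, c => c.flatMap fun p => (pairwiseLists r k (c.filter (r p))).map (p :: ·)

theorem mem_pairwiseLists {α : Type*} (r : α → α → Bool) (k : ℕ) (c l : List α) :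
    l ∈ pairwiseLists r k c ↔
      l.length = k ∧ l.Pairwise (fun x y => r x y = true) ∧ ∀ x ∈ l, x ∈ c := by
  induction k generalizing c l with
  | zero => cases l <;> simp [pairwiseLists]
  | succ k ih =>
    cases l with
    | nil => simp [pairwiseLists]
    | cons a l =>
      simp only [pairwiseLists, List.mem_flatMap, List.mem_map, List.cons.injEq, ih,
        List.mem_filter, List.length_cons, List.pairwise_cons, List.mem_cons]
      constructor
      · rintro ⟨p, hp, l', ⟨hl, hr, hc⟩, rfl, rfl⟩
        grind
      · rintro ⟨hl, ⟨ha, hr⟩, hc⟩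
        exact ⟨a, hc a (.inl rfl), l, ⟨by omega, hr, fun x hx => ⟨hc x (.inr hx), ha x hx⟩⟩,
          rfl, rfl⟩

theorem nodup_pairwiseLists {α : Type*} (r : α → α → Bool) (k : ℕ) (c : List α) (hc : c.Nodup) :
    (pairwiseLists r k c).Nodup := by
  induction k generalizing c with
  | zero => simp [pairwiseLists]
  | succ k ih =>
    rw [pairwiseLists, List.nodup_flatMap]
    refine ⟨fun p _ => (ih _ (hc.filter _)).map (List.cons_injective), ?_⟩
    refine hc.imp fun {a b} hab => ?_
    simp only [Function.onFun, List.disjoint_left, List.mem_map]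
    grind

/-- The rows of a two-column tableau with entries in `{0, …, 7}`. -/
def twoColRows : List (Fin 8 × Fin 8) :=
  (List.finRange 8 ×ˢ List.finRange 8).filter fun p => p.1 ≤ p.2

/-- The semistandard Young tableaux of shape `(2, 2, 2, 2, 2)` with entries in `{0, …, 7}`,
each as the list of its rows. -/
def twoColTableaux : List (List (Fin 8 × Fin 8)) :=
  pairwiseLists (fun p q => decide (p.1 < q.1) && decide (p.2 < q.2)) 5 twoColRows

theorem nodup_twoColTableaux : twoColTableaux.Nodup :=
  nodup_pairwiseLists _ _ _ (((List.nodup_finRange 8).product (List.nodup_finRange 8)).filter _)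

/-- The number of occurrences of `i` in a list of rows. -/
def rowsCount (i : Fin 8) (t : List (Fin 8 × Fin 8)) : ℕ :=
  (t.map fun p => (if p.1 = i then 1 else 0) + (if p.2 = i then 1 else 0)).sum

theorem sum_rowsCount (i : Fin 8) :
    (twoColTableaux.map (rowsCount i)).sum = 1470 := by
  revert i
  decide +kernel

theorem sum_rowsCount_mul (i j : Fin 8) :
    (twoColTableaux.map fun t => rowsCount i t * rowsCount j t).sum =
      if i = j then 2450 else 1750 := by
  revert i j
  decide +kernel

theorem sum_X_rows (t : List (Fin 8 × Fin 8)) :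
    (t.map fun p => (X p.1 + X p.2 : MvPolynomial (Fin 8) ℤ)).sum =
      ∑ i, (rowsCount i t : MvPolynomial (Fin 8) ℤ) * X i := by
  induction t with
  | nil => simp [rowsCount]
  | cons p t ih =>
    simp only [List.map_cons, List.sum_cons, ih, rowsCount, Nat.cast_add, add_mul,
      Finset.sum_add_distrib, Nat.cast_ite, Nat.cast_one, Nat.cast_zero, ite_mul, one_mul,
      zero_mul, Finset.sum_ite_eq, Finset.mem_univ, if_true]

theorem injective_ofFn_rows {k : ℕ} {α : Type*} :
    Function.Injective fun T : Fin k → Fin 2 → α => List.ofFn fun i => (T i 0, T i 1) := by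
  intro S T h
  have h' := List.ofFn_injective h
  funext i j
  have hi := congrFun h' i
  simp only [Prod.mk.injEq] at hi
  fin_cases j
  · exact hi.1
  · exact hi.2

theorem map_rows_eq_twoColTableaux (F : Finset (Fin 5 → Fin 2 → Fin 8))
    (hF : ∀ T, T ∈ F ↔
      (∀ i, T i 0 ≤ T i 1) ∧ ∀ i i', i < i' → T i 0 < T i' 0 ∧ T i 1 < T i' 1) :
    F.val.map (fun T => List.ofFn fun i => (T i 0, T i 1)) =
      (twoColTableaux : Multiset (List (Fin 8 × Fin 8))) := by
  refine (Multiset.Nodup.ext (F.nodup.map injective_ofFn_rows)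
    (Multiset.coe_nodup.2 nodup_twoColTableaux)).2 fun l => ?_
  rw [Multiset.mem_coe, twoColTableaux, mem_pairwiseLists]
  simp only [Multiset.mem_map, Finset.mem_val, hF, twoColRows, List.mem_filter,
    Bool.and_eq_true, decide_eq_true_eq]
  constructor
  · rintro ⟨T, ⟨h1, h2⟩, rfl⟩
    refine ⟨List.length_ofFn, List.pairwise_ofFn.2 fun i j hij => h2 i j hij, fun x hx => ?_⟩
    obtain ⟨i, rfl⟩ := (List.mem_ofFn' _ _).1 hx
    exact ⟨by simp, h1 i⟩
  · rintro ⟨hl, hp, hm⟩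
    obtain ⟨f, rfl⟩ : ∃ f : Fin 5 → Fin 8 × Fin 8, l = List.ofFn f :=
      ⟨fun i => l.get (i.cast hl.symm), List.ext_get (hl.trans List.length_ofFn.symm) fun _ _ _ => by
        simp only [List.get_eq_getElem, List.getElem_ofFn, Fin.val_cast]⟩
    rw [List.pairwise_ofFn] at hp
    exact ⟨fun i => ![(f i).1, (f i).2],
      ⟨fun i => (hm (f i) ((List.mem_ofFn' _ _).2 ⟨i, rfl⟩)).2, fun i j hij => hp hij⟩, rfl⟩

theorem map_weight_eq_twoColTableaux (g : Fin 5 → ℕ) (hg : g = fun _ => 2)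
    (F : Finset ((i : Fin 5) → Fin (g i) → Fin 8))
    (hF : ∀ T, T ∈ F ↔
      (∀ (i : Fin 5) (j j' : Fin (g i)), (j : ℕ) ≤ (j' : ℕ) → T i j ≤ T i j') ∧
      (∀ (i i' : Fin 5), (i : ℕ) < (i' : ℕ) →
        ∀ (j : Fin (g i')) (hj : (j : ℕ) < g i), T i ⟨j, hj⟩ < T i' j)) :
    F.val.map (fun T => ∑ i, ∑ j, (X (T i j) : MvPolynomial (Fin 8) ℤ)) =
      (twoColTableaux : Multiset (List (Fin 8 × Fin 8))).map fun t =>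
        ∑ i, (rowsCount i t : MvPolynomial (Fin 8) ℤ) * X i := by
  subst hg
  rw [← map_rows_eq_twoColTableaux F, Multiset.map_map]
  · refine Multiset.map_congr rfl fun T _ => ?_
    simp only [Function.comp_apply, ← sum_X_rows, List.map_ofFn, List.sum_ofFn, Fin.sum_univ_two]
  · intro T
    rw [hF]
    constructor
    · rintro ⟨h1, h2⟩
      exact ⟨fun i => h1 i 0 1 (by simp), fun i i' hi =>
        ⟨h2 i i' hi 0 (by simp), h2 i i' hi 1 (by simp)⟩⟩
    · rintro ⟨h1, h2⟩
      refine ⟨fun i j j' hj => ?_, fun i i' hi j _ => ?_⟩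
      · fin_cases j <;> fin_cases j'
        · exact le_rfl
        · exact h1 i
        · simp at hj
        · exact le_rfl
      · fin_cases j
        · exact (h2 i i' hi).1
        · exact (h2 i i' hi).2

theorem exists_ssytWeights_eq_map (lam : List ℕ) (n : ℕ) :
    ∃ F : Finset ((i : Fin lam.length) → Fin (lam.get i) → Fin n),
      (∀ T, T ∈ F ↔
        (∀ (i : Fin lam.length) (j j' : Fin (lam.get i)), (j : ℕ) ≤ (j' : ℕ) → T i j ≤ T i j') ∧
        (∀ (i i' : Fin lam.length), (i : ℕ) < (i' : ℕ) →
          ∀ (j : Fin (lam.get i')) (hj : (j : ℕ) < lam.get i), T i ⟨j, hj⟩ < T i' j)) ∧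
      ssytWeights lam n = F.val.map fun T => ∑ i, ∑ j, X (T i j) :=
  ⟨_, fun T => Finset.mem_filter.trans (and_iff_right (Finset.mem_univ T)), rfl⟩

theorem ssytWeights_eq_twoColTableaux :
    ssytWeights [2, 2, 2, 2, 2] 8 =
      (twoColTableaux : Multiset (List (Fin 8 × Fin 8))).map fun t =>
        ∑ i, (rowsCount i t : MvPolynomial (Fin 8) ℤ) * X i := by
  obtain ⟨F, hF, h⟩ := exists_ssytWeights_eq_map [2, 2, 2, 2, 2] 8
  rw [h]
  refine map_weight_eq_twoColTableaux [2, 2, 2, 2, 2].get ?_ F hF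
  funext i
  fin_cases i <;> rfl

theorem List.sum_map_finset_sum {α ι M : Type*} [AddCommMonoid M] (l : List α) (s : Finset ι)
    (f : ι → α → M) :
    (l.map fun a => ∑ i ∈ s, f i a).sum = ∑ i ∈ s, (l.map (f i)).sum := by
  induction l with
  | nil => simp
  | cons a l ih => simp [ih, Finset.sum_add_distrib]

theorem sum_ssytWeights :
    (ssytWeights [2, 2, 2, 2, 2] 8).sum = 1470 * ∑ i, X i := by
  rw [ssytWeights_eq_twoColTableaux, Multiset.map_coe, Multiset.sum_coe,
    List.sum_map_finset_sum, Finset.mul_sum]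
  refine Finset.sum_congr rfl fun i _ => ?_
  have h := congrArg (Nat.cast : ℕ → MvPolynomial (Fin 8) ℤ) (sum_rowsCount i)
  rw [Nat.cast_list_sum, List.map_map] at h
  rw [List.sum_map_mul_right]
  exact congrArg (· * X i) h

theorem sum_sq_ssytWeights :
    ((ssytWeights [2, 2, 2, 2, 2] 8).map (· ^ 2)).sum =
      700 * ∑ i, X i ^ 2 + 1750 * (∑ i, X i) ^ 2 := by
  have hsq (t : List (Fin 8 × Fin 8)) :
      (∑ i, (rowsCount i t : MvPolynomial (Fin 8) ℤ) * X i) ^ 2 =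
        ∑ i, ∑ j, ((rowsCount i t * rowsCount j t : ℕ) : MvPolynomial (Fin 8) ℤ) *
          (X i * X j) := by
    rw [sq, Finset.sum_mul_sum]
    refine Finset.sum_congr rfl fun i _ => Finset.sum_congr rfl fun j _ => ?_
    push_cast
    ring
  have hcoef (i j : Fin 8) :
      (twoColTableaux.map fun t =>
        ((rowsCount i t * rowsCount j t : ℕ) : MvPolynomial (Fin 8) ℤ) * (X i * X j)).sum =
        (if i = j then 700 * X i ^ 2 else 0) + 1750 * (X i * X j) := by
    have h := congrArg (Nat.cast : ℕ → MvPolynomial (Fin 8) ℤ) (sum_rowsCount_mul i j)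
    rw [Nat.cast_list_sum, List.map_map] at h
    rw [List.sum_map_mul_right]
    refine (congrArg (· * (X i * X j)) h).trans ?_
    split_ifs with hij
    · subst hij
      push_cast
      ring
    · push_cast
      ring
  rw [ssytWeights_eq_twoColTableaux, Multiset.map_map, Multiset.map_coe, Multiset.sum_coe]
  simp only [Function.comp_def, hsq, List.sum_map_finset_sum, hcoef, Finset.sum_add_distrib,
    Finset.sum_ite_eq, Finset.mem_univ, if_true]
  rw [sq (∑ i, X i), Finset.sum_mul_sum]
  simp only [Finset.mul_sum]

/-- `c₂(γ8^[2, 2, 2, 2, 2]) = 700·c₂(γ8)`: the second elementary symmetric function of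
the multiset of weights of semistandard Young tableaux of shape `[2, 2, 2, 2, 2]` with
entries in `{0, …, 7}` is congruent to `700·e₂` modulo the ideal generated
by `e₁`. -/
theorem c2_ssyt_stmt5 :
    Multiset.esymm (ssytWeights [2, 2, 2, 2, 2] 8) 2 - 700 * esymm (Fin 8) ℤ 2
      ∈ Ideal.span {esymm (Fin 8) ℤ 1} := by
  have h1 := Multiset.two_mul_esymm_two (ssytWeights [2, 2, 2, 2, 2] 8)
  have h2 := Multiset.two_mul_esymm_two
    ((Finset.univ : Finset (Fin 8)).val.map (X : Fin 8 → MvPolynomial (Fin 8) ℤ))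
  rw [← esymm_eq_multiset_esymm, Multiset.map_map] at h2
  change _ = (∑ i, X i) ^ 2 - ∑ i, X i ^ 2 at h2
  rw [sum_ssytWeights, sum_sq_ssytWeights] at h1
  rw [esymm_one, Ideal.mem_span_singleton]
  refine ⟨1079225 * ∑ i, X i, mul_left_cancel₀ (two_ne_zero (α := MvPolynomial (Fin 8) ℤ)) ?_⟩
  linear_combination h1 - 700 * h2
end

section
/- In R = MvPolynomial (Fin 9) ℤ, the second elementary symmetric function of the multiset W((2,2,1,1), 9) of weights of semistandard Young tableaux of shape (2,2,1,1) with entries in {0,…,8} is congruent to 1701·e₂ modulo the ideal generated by e₁; equivalently, c₂(γ₉^{(2,2,1,1)}) = 1701·c₂(γ₉), the Table 2 entry for the weight α₂+α₄ of SL₉/μ₃. -/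
open MvPolynomial

/-- `boundedSum n f` is `∑ k < n, f k`, by a recursion that the kernel evaluates quickly. -/
def boundedSum : ℕ → (ℕ → ℕ) → ℕ
  | 0, _ => 0
  | n + 1, f => boundedSum n f + f n

/-- The sum of `f` over pairs of columns `a₀ < a₁ < a₂ < a₃ < 9` and `b₀ < b₁ < 9` that fit together
to a semistandard tableau of shape `[2, 2, 1, 1]`. -/
def columnPairSum (f : ℕ → ℕ → ℕ → ℕ → ℕ → ℕ → ℕ) : ℕ :=
  boundedSum 9 fun a₃ => boundedSum a₃ fun a₂ => boundedSum a₂ fun a₁ => boundedSum a₁ fun a₀ =>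
    boundedSum 9 fun b₁ => cond (a₁.ble b₁)
      (boundedSum b₁ fun b₀ => cond (a₀.ble b₀) (f a₃ a₂ a₁ a₀ b₁ b₀) 0) 0

/-- The sum `x ^ a₃ + ⋯ + x ^ b₀` over the six entries of a pair of columns. -/
def powerSum (x a₃ a₂ a₁ a₀ b₁ b₀ : ℕ) : ℕ :=
  x ^ a₃ + x ^ a₂ + x ^ a₁ + x ^ a₀ + x ^ b₁ + x ^ b₀

theorem columnPairSum_one : columnPairSum (fun _ _ _ _ _ _ => 1) = 3402 := by
  decide +kernel

theorem columnPairSum_powerSum :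
    columnPairSum (powerSum (2 ^ 20)) = ∑ i : Fin 9, 2268 * (2 ^ 20) ^ (i : ℕ) := by
  decide +kernel

theorem columnPairSum_powerSum_mul :
    columnPairSum (fun a₃ a₂ a₁ a₀ b₁ b₀ => powerSum ((2 ^ 20) ^ 9) a₃ a₂ a₁ a₀ b₁ b₀ *
      powerSum (2 ^ 20) a₃ a₂ a₁ a₀ b₁ b₀) =
    ∑ i : Fin 9, (∑ j : Fin 9, (if i = j then 3024 else 1323) * (2 ^ 20) ^ (j : ℕ)) *
      ((2 ^ 20) ^ 9) ^ (i : ℕ) := by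
  decide +kernel

theorem sum_mul_pow_lt {n m : ℕ} {c : Fin n → ℕ} (hc : ∀ i, c i < m) :
    ∑ i, c i * m ^ (i : ℕ) < m ^ n := by
  have h := (finFunctionFinEquiv fun i => (⟨c i, hc i⟩ : Fin m)).isLt
  rwa [finFunctionFinEquiv_apply] at h

/-- Uniqueness of base `m` digits. -/
theorem eq_of_sum_mul_pow_eq {n m : ℕ} {c d : Fin n → ℕ} (hc : ∀ i, c i < m) (hd : ∀ i, d i < m)
    (h : ∑ i, c i * m ^ (i : ℕ) = ∑ i, d i * m ^ (i : ℕ)) : c = d := by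
  have h' : (fun i => (⟨c i, hc i⟩ : Fin m)) = fun i => ⟨d i, hd i⟩ := by
    apply finFunctionFinEquiv.injective
    apply Fin.ext
    simpa only [finFunctionFinEquiv_apply] using h
  funext i
  exact congrArg Fin.val (congrFun h' i)

theorem boundedSum_eq_sum_range (n : ℕ) (f : ℕ → ℕ) :
    boundedSum n f = ∑ k ∈ Finset.range n, f k := by
  induction n with
  | zero => rfl
  | succ n ih => rw [boundedSum, ih, Finset.sum_range_succ]

theorem boundedSum_eq_sum_fin {m n : ℕ} (h : m ≤ n) (f : ℕ → ℕ) :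
    boundedSum m f = ∑ k : Fin n, if (k : ℕ) < m then f k else 0 := by
  rw [boundedSum_eq_sum_range, Fin.sum_univ_eq_sum_range (fun k => if k < m then f k else 0),
    ← Finset.sum_filter]
  congr 1
  ext k
  simp only [Finset.mem_range, Finset.mem_filter]
  omega

theorem columnPairSum_eq_sum (f : ℕ → ℕ → ℕ → ℕ → ℕ → ℕ → ℕ) :
    columnPairSum f = ∑ p : Fin 9 × Fin 9 × Fin 9 × Fin 9 × Fin 9 × Fin 9,
      if p.2.1 < p.1 ∧ p.2.2.1 < p.2.1 ∧ p.2.2.2.1 < p.2.2.1 ∧ p.2.2.1 ≤ p.2.2.2.2.1 ∧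
          p.2.2.2.2.2 < p.2.2.2.2.1 ∧ p.2.2.2.1 ≤ p.2.2.2.2.2 then
        f p.1 p.2.1 p.2.2.1 p.2.2.2.1 p.2.2.2.2.1 p.2.2.2.2.2 else 0 := by
  simp only [Fintype.sum_prod_type, columnPairSum, Bool.cond_eq_ite, Nat.ble_eq]
  rw [boundedSum_eq_sum_fin le_rfl]
  refine Finset.sum_congr rfl fun a₃ _ => ?_
  rw [if_pos a₃.isLt, boundedSum_eq_sum_fin a₃.isLt.le]
  refine Finset.sum_congr rfl fun a₂ _ => ?_
  split_ifs with h₂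
  swap
  · simp [show ¬ a₂ < a₃ from h₂]
  rw [boundedSum_eq_sum_fin a₂.isLt.le]
  refine Finset.sum_congr rfl fun a₁ _ => ?_
  split_ifs with h₁
  swap
  · simp [show ¬ a₁ < a₂ from h₁]
  rw [boundedSum_eq_sum_fin a₁.isLt.le]
  refine Finset.sum_congr rfl fun a₀ _ => ?_
  split_ifs with h₀
  swap
  · simp [show ¬ a₀ < a₁ from h₀]
  rw [boundedSum_eq_sum_fin le_rfl]
  refine Finset.sum_congr rfl fun b₁ _ => ?_
  rw [if_pos b₁.isLt]
  split_ifs with h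
  swap
  · simp [show ¬ a₁ ≤ b₁ from h]
  rw [boundedSum_eq_sum_fin b₁.isLt.le]
  refine Finset.sum_congr rfl fun b₀ _ => ?_
  simp only [Fin.lt_def, Fin.le_def] at *
  simp only [h₂, h₁, h₀, h, true_and]
  split_ifs <;> first | rfl | omega

/-- Fillings of the shape `[2, 2, 1, 1]` with entries in `Fin 9`. -/
abbrev Filling : Type :=
  (i : Fin [2, 2, 1, 1].length) → Fin ([2, 2, 1, 1].get i) → Fin 9

/-- A filling is determined by its columns, listed from the bottom up. -/
def columnsEquiv : Fin 9 × Fin 9 × Fin 9 × Fin 9 × Fin 9 × Fin 9 ≃ Filling where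
  toFun p i j :=
    if (j : ℕ) = 0 then ![p.2.2.2.1, p.2.2.1, p.2.1, p.1] i
    else ![p.2.2.2.2.2, p.2.2.2.2.1, 0, 0] i
  invFun T := (T 3 ⟨0, by decide⟩, T 2 ⟨0, by decide⟩, T 1 ⟨0, by decide⟩, T 0 ⟨0, by decide⟩,
    T 1 ⟨1, by decide⟩, T 0 ⟨1, by decide⟩)
  left_inv _ := rfl
  right_inv T := by
    funext i j
    fin_cases i <;> fin_cases j <;> rfl

/-- The semistandard condition on fillings. -/
def IsSemistandard (T : Filling) : Prop :=
  (∀ (i : Fin [2, 2, 1, 1].length) (j j' : Fin ([2, 2, 1, 1].get i)),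
    (j : ℕ) ≤ (j' : ℕ) → T i j ≤ T i j') ∧
  (∀ (i i' : Fin [2, 2, 1, 1].length), (i : ℕ) < (i' : ℕ) →
    ∀ (j : Fin ([2, 2, 1, 1].get i')) (hj : (j : ℕ) < [2, 2, 1, 1].get i), T i ⟨j, hj⟩ < T i' j)

theorem isSemistandard_columnsEquiv (p : Fin 9 × Fin 9 × Fin 9 × Fin 9 × Fin 9 × Fin 9) :
    IsSemistandard (columnsEquiv p) ↔
      p.2.1 < p.1 ∧ p.2.2.1 < p.2.1 ∧ p.2.2.2.1 < p.2.2.1 ∧ p.2.2.1 ≤ p.2.2.2.2.1 ∧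
        p.2.2.2.2.2 < p.2.2.2.2.1 ∧ p.2.2.2.1 ≤ p.2.2.2.2.2 := by
  constructor
  · rintro ⟨hr, hc⟩
    exact ⟨hc 2 3 (by decide) ⟨0, by decide⟩ (by decide),
      hc 1 2 (by decide) ⟨0, by decide⟩ (by decide),
      hc 0 1 (by decide) ⟨0, by decide⟩ (by decide),
      hr 1 ⟨0, by decide⟩ ⟨1, by decide⟩ (by decide),
      hc 0 1 (by decide) ⟨1, by decide⟩ (by decide),
      hr 0 ⟨0, by decide⟩ ⟨1, by decide⟩ (by decide)⟩
  · obtain ⟨a₃, a₂, a₁, a₀, b₁, b₀⟩ := p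
    rintro ⟨h₁, h₂, h₃, h₄, h₅, h₆⟩
    dsimp only at h₁ h₂ h₃ h₄ h₅ h₆
    constructor
    · intro i j j' h
      fin_cases i <;> fin_cases j <;> fin_cases j' <;>
        first
        | exact le_rfl
        | exact h₄
        | exact h₆
        | exact absurd h (by decide)
    · intro i i' h j hj
      fin_cases i <;> fin_cases i' <;> first
        | exact absurd h (by decide)
        | (fin_cases j <;> first
            | exact absurd hj (by decide)
            | exact h₁
            | exact h₂
            | exact h₃
            | exact h₅
            | exact h₂.trans h₁
            | exact h₃.trans h₂
            | exact (h₃.trans h₂).trans h₁)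

/-- The number of cells of a filling with entry `i`. -/
def cellCount (i : Fin 9) (T : Filling) : ℕ := ∑ r, ∑ c, if T r c = i then 1 else 0

theorem sum_cells_eq {R : Type*} [CommSemiring R] (f : Fin 9 → R) (T : Filling) :
    ∑ r, ∑ c, f (T r c) = ∑ i, (cellCount i T : R) * f i := by
  simp only [cellCount, Nat.cast_sum, Finset.sum_mul]
  rw [Finset.sum_comm]
  refine Finset.sum_congr rfl fun r _ => ?_
  rw [Finset.sum_comm]
  refine Finset.sum_congr rfl fun c _ => ?_
  simp

theorem cellCount_le (i : Fin 9) (T : Filling) : cellCount i T ≤ 6 :=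
  (Finset.sum_le_sum fun r _ => Finset.sum_le_sum fun c _ => by split_ifs <;> simp).trans
    (show (∑ r : Fin [2, 2, 1, 1].length, ∑ _c : Fin ([2, 2, 1, 1].get r), 1) ≤ 6 by decide)

theorem sum_cellCount_mul_pow_columnsEquiv (x : ℕ)
    (p : Fin 9 × Fin 9 × Fin 9 × Fin 9 × Fin 9 × Fin 9) :
    ∑ i, cellCount i (columnsEquiv p) * x ^ (i : ℕ) =
      powerSum x p.1 p.2.1 p.2.2.1 p.2.2.2.1 p.2.2.2.2.1 p.2.2.2.2.2 := by
  obtain ⟨a₃, a₂, a₁, a₀, b₁, b₀⟩ := p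
  have key (F : (r : Fin [2, 2, 1, 1].length) → Fin ([2, 2, 1, 1].get r) → ℕ) :
      ∑ r, ∑ c, F r c = (F 0 (0 : Fin 2) + F 0 (1 : Fin 2)) +
        (F 1 (0 : Fin 2) + F 1 (1 : Fin 2)) + F 2 (0 : Fin 1) + F 3 (0 : Fin 1) := by
    refine (Fin.sum_univ_four (fun r : Fin 4 => ∑ c, F r c)).trans ?_
    refine congrArg₂ _ (congrArg₂ _ (congrArg₂ _ ?_ ?_) ?_) ?_
    · exact Fin.sum_univ_two (F 0)
    · exact Fin.sum_univ_two (F 1)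
    · exact Fin.sum_univ_one (F 2)
    · exact Fin.sum_univ_one (F 3)
  refine (sum_cells_eq (fun i : Fin 9 => x ^ (i : ℕ)) _).symm.trans ((key _).trans ?_)
  change (x ^ (a₀ : ℕ) + x ^ (b₀ : ℕ)) + (x ^ (a₁ : ℕ) + x ^ (b₁ : ℕ)) + x ^ (a₂ : ℕ) +
    x ^ (a₃ : ℕ) = x ^ (a₃ : ℕ) + x ^ (a₂ : ℕ) + x ^ (a₁ : ℕ) + x ^ (a₀ : ℕ) + x ^ (b₁ : ℕ) +
    x ^ (b₀ : ℕ)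
  ring

open scoped Classical in
/-- The semistandard tableaux of shape `[2, 2, 1, 1]` with entries in `Fin 9`. -/
noncomputable def tableaux : Finset Filling := Finset.univ.filter IsSemistandard

theorem sum_tableaux (g : Filling → ℕ) (f : ℕ → ℕ → ℕ → ℕ → ℕ → ℕ → ℕ)
    (h : ∀ p, g (columnsEquiv p) = f p.1 p.2.1 p.2.2.1 p.2.2.2.1 p.2.2.2.2.1 p.2.2.2.2.2) :
    ∑ T ∈ tableaux, g T = columnPairSum f := by
  classical
  rw [tableaux, Finset.sum_filter, columnPairSum_eq_sum, ← Equiv.sum_comp columnsEquiv]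
  refine Finset.sum_congr rfl fun p _ => ?_
  rw [h]
  exact if_congr (isSemistandard_columnsEquiv p) rfl rfl

theorem card_tableaux : tableaux.card = 3402 := by
  rw [Finset.card_eq_sum_ones, sum_tableaux (fun _ => 1) (fun _ _ _ _ _ _ => 1) fun _ => rfl,
    columnPairSum_one]

theorem sum_tableaux_le {g : Filling → ℕ} {k : ℕ} (h : ∀ T, g T ≤ k) :
    ∑ T ∈ tableaux, g T ≤ 3402 * k := by
  rw [← card_tableaux, ← smul_eq_mul]
  exact Finset.sum_le_card_nsmul _ _ _ fun T _ => h T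

theorem sum_sum_cellCount_mul_pow (x : ℕ) :
    ∑ i : Fin 9, (∑ T ∈ tableaux, cellCount i T) * x ^ (i : ℕ) = columnPairSum (powerSum x) := by
  rw [← sum_tableaux (fun T => ∑ i, cellCount i T * x ^ (i : ℕ)) _
    (sum_cellCount_mul_pow_columnsEquiv x), Finset.sum_comm]
  simp only [Finset.sum_mul]

theorem sum_cellCount (i : Fin 9) : ∑ T ∈ tableaux, cellCount i T = 2268 := by
  obtain ⟨m, hm⟩ : ∃ m, m = 2 ^ 20 := ⟨_, rfl⟩
  have hc (i : Fin 9) : ∑ T ∈ tableaux, cellCount i T < m :=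
    (sum_tableaux_le (cellCount_le i)).trans_lt (by norm_num [hm])
  have hd (_ : Fin 9) : 2268 < m := by norm_num [hm]
  have h := columnPairSum_powerSum
  rw [← hm, ← sum_sum_cellCount_mul_pow] at h
  exact congrFun (eq_of_sum_mul_pow_eq hc hd h) i

theorem sum_sum_cellCount_mul_mul_pow (x y : ℕ) :
    ∑ i : Fin 9, (∑ j : Fin 9, (∑ T ∈ tableaux, cellCount i T * cellCount j T) * y ^ (j : ℕ)) *
      x ^ (i : ℕ) = columnPairSum fun a₃ a₂ a₁ a₀ b₁ b₀ =>
        powerSum x a₃ a₂ a₁ a₀ b₁ b₀ * powerSum y a₃ a₂ a₁ a₀ b₁ b₀ := by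
  rw [← sum_tableaux (fun T => (∑ i, cellCount i T * x ^ (i : ℕ)) *
    ∑ j, cellCount j T * y ^ (j : ℕ)) _ fun p => congrArg₂ (· * ·)
      (sum_cellCount_mul_pow_columnsEquiv x p) (sum_cellCount_mul_pow_columnsEquiv y p)]
  simp only [Finset.sum_mul, Finset.mul_sum]
  rw [Finset.sum_comm (s := tableaux), Finset.sum_comm]
  refine Finset.sum_congr rfl fun j _ => ?_
  rw [Finset.sum_comm (s := tableaux)]
  refine Finset.sum_congr rfl fun i _ => Finset.sum_congr rfl fun T _ => ?_
  ring

theorem sum_cellCount_mul (i j : Fin 9) :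
    ∑ T ∈ tableaux, cellCount i T * cellCount j T = if i = j then 3024 else 1323 := by
  obtain ⟨m, hm⟩ : ∃ m, m = 2 ^ 20 := ⟨_, rfl⟩
  have hc (i j : Fin 9) : ∑ T ∈ tableaux, cellCount i T * cellCount j T < m :=
    (sum_tableaux_le fun T => Nat.mul_le_mul (cellCount_le i T) (cellCount_le j T)).trans_lt
      (by norm_num [hm])
  have hd (i j : Fin 9) : (if i = j then 3024 else 1323) < m := by split_ifs <;> norm_num [hm]
  have h := columnPairSum_powerSum_mul
  rw [← hm, ← sum_sum_cellCount_mul_mul_pow] at h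
  exact congrFun (eq_of_sum_mul_pow_eq (hc i) (hd i) (congrFun (eq_of_sum_mul_pow_eq
    (fun i => sum_mul_pow_lt (hc i)) (fun i => sum_mul_pow_lt (hd i)) h) i)) j

/-- The weight of a filling. -/
noncomputable def weight (T : Filling) : MvPolynomial (Fin 9) ℤ := ∑ r, ∑ c, X (T r c)

theorem ssytWeights_eq : ssytWeights [2, 2, 1, 1] 9 = tableaux.val.map weight := by
  refine congrArg (fun s : Finset Filling => s.val.map weight) ?_
  ext T
  simp only [tableaux, Finset.mem_filter]
  exact Iff.rfl

theorem weight_eq (T : Filling) :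
    weight T = ∑ i, (cellCount i T : MvPolynomial (Fin 9) ℤ) * X i :=
  sum_cells_eq X T

theorem sum_weight : ∑ T ∈ tableaux, weight T = 2268 * ∑ i, X i := by
  simp only [weight_eq]
  rw [Finset.sum_comm, Finset.mul_sum]
  refine Finset.sum_congr rfl fun i _ => ?_
  rw [← Finset.sum_mul, ← Nat.cast_sum, sum_cellCount]
  rfl

theorem sum_weight_sq :
    ∑ T ∈ tableaux, weight T ^ 2 = 1323 * (∑ i, X i) ^ 2 + 1701 * ∑ i, X i ^ 2 := by
  have h (i j : Fin 9) : ∑ T ∈ tableaux,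
      ((cellCount i T : MvPolynomial (Fin 9) ℤ) * X i) *
        ((cellCount j T : MvPolynomial (Fin 9) ℤ) * X j) =
        1323 * (X i * X j) + if i = j then 1701 * (X i * X j) else 0 := by
    have h' := congrArg (Nat.cast : ℕ → MvPolynomial (Fin 9) ℤ) (sum_cellCount_mul i j)
    push_cast at h'
    rw [Finset.sum_congr rfl fun T _ => mul_mul_mul_comm _ _ _ _, ← Finset.sum_mul, h']
    split_ifs <;> ring
  simp only [weight_eq, sq, Finset.sum_mul_sum]
  rw [Finset.sum_comm, Finset.mul_sum, Finset.mul_sum, ← Finset.sum_add_distrib]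
  refine Finset.sum_congr rfl fun i _ => ?_
  rw [Finset.sum_comm]
  simp only [h, Finset.sum_add_distrib, Finset.sum_ite_eq, Finset.mem_univ, if_true, Finset.mul_sum]

theorem Multiset.sq_sum_eq_sum_map_sq_add_two_mul_esymm {R : Type*} [CommRing R]
    (s : Multiset R) : s.sum ^ 2 = (s.map (· ^ 2)).sum + 2 * s.esymm 2 := by
  induction s using Multiset.induction_on with
  | empty => simp [Multiset.esymm, Multiset.powersetCard_zero_right]
  | cons a s ih =>
    have h : (a ::ₘ s).esymm 2 = s.esymm 2 + a * s.sum := by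
      simpa [Multiset.esymm, Multiset.powersetCard_one] using
        Multiset.sum_map_mul_left (s := s) (f := id)
    rw [h, Multiset.sum_cons, Multiset.map_cons, Multiset.sum_cons]
    linear_combination ih

theorem sq_sum_X_eq : (∑ i, X i) ^ 2 = ∑ i, X i ^ 2 + 2 * esymm (Fin 9) ℤ 2 := by
  have h := Multiset.sq_sum_eq_sum_map_sq_add_two_mul_esymm
    ((Finset.univ : Finset (Fin 9)).val.map (X : Fin 9 → MvPolynomial (Fin 9) ℤ))
  rwa [← esymm_eq_multiset_esymm, Multiset.map_map] at h

/-- `c₂(γ9^[2, 2, 1, 1]) = 1701·c₂(γ9)`: the second elementary symmetric function of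
the multiset of weights of semistandard Young tableaux of shape `[2, 2, 1, 1]` with
entries in `{0, …, 8}` is congruent to `1701·e₂` modulo the ideal generated
by `e₁`. -/
theorem c2_ssyt_stmt15 :
    Multiset.esymm (ssytWeights [2, 2, 1, 1] 9) 2 - 1701 * esymm (Fin 9) ℤ 2
      ∈ Ideal.span {esymm (Fin 9) ℤ 1} := by
  rw [Ideal.mem_span_singleton, esymm_one]
  refine ⟨2570400 * ∑ i, X i, ?_⟩
  have h := Multiset.sq_sum_eq_sum_map_sq_add_two_mul_esymm (ssytWeights [2, 2, 1, 1] 9)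
  have h₁ : (ssytWeights [2, 2, 1, 1] 9).sum = 2268 * ∑ i, X i := by
    rw [ssytWeights_eq]
    exact sum_weight
  have h₂ : ((ssytWeights [2, 2, 1, 1] 9).map (· ^ 2)).sum =
      1323 * (∑ i, X i) ^ 2 + 1701 * ∑ i, X i ^ 2 := by
    rw [ssytWeights_eq, Multiset.map_map]
    exact sum_weight_sq
  rw [h₁, h₂] at h
  refine mul_left_cancel₀ (two_ne_zero : (2 : MvPolynomial (Fin 9) ℤ) ≠ 0) ?_
  linear_combination -h + 1701 * sq_sum_X_eq
end
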